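/- Let B be a real p×q matrix and C = Bᵀ, and define S_i and T_i by S₁ = [[2·I_p, B],[0, 0]], T₁ = [[0, 0],[C, 2·I_q]], S₂ = S₁·T₁, T₂ = T₁·S₁, and, for i ≥ 2, S_{i+1} = S₁·T_i − S_{i−1} and T_{i+1} = T₁·S_i − T_{i−1}. If for some n ≥ 1 both S_n = 0 and T_n = 0, then f_n(B·Bᵀ) = 0 and f_n(Bᵀ·B) = 0. -/

import Mathlib

open Matrix Polynomial

/-- `f₀ = 0`, `f₁ = 1`, `fᵢ = f_{i−1} − f_{i−2}` for odd `i ≥ 2` and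
`fᵢ = x·f_{i−1} − f_{i−2}` for even `i ≥ 2`. -/
noncomputable def fpoly : ℕ → Polynomial ℤ
  | 0 => 0
  | 1 => 1
  | (n + 2) =>
      if (n + 2) % 2 = 1 then fpoly (n + 1) - fpoly n
      else X * fpoly (n + 1) - fpoly n

theorem fpoly_odd (k : ℕ) : fpoly (2 * k + 3) = fpoly (2 * k + 2) - fpoly (2 * k + 1) := by
  rw [fpoly, if_pos (by omega)]

theorem fpoly_even (k : ℕ) :
    fpoly (2 * k + 4) = X * fpoly (2 * k + 3) - fpoly (2 * k + 2) := by
  rw [fpoly, if_neg (by omega)]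

theorem fpoly_two : fpoly 2 = X := by
  simp [fpoly]

theorem aeval_mul_intertwine {m n : Type*} [Fintype m] [Fintype n] [DecidableEq m]
    [DecidableEq n] (B : Matrix m n ℝ) (C : Matrix n m ℝ) (f : Polynomial ℤ) :
    B * aeval (C * B) f = aeval (B * C) f * B := by
  induction f using Polynomial.induction_on' with
  | add f g hf hg => simp only [map_add, Matrix.mul_add, Matrix.add_mul, hf, hg]
  | monomial d a =>
    have key : B * (C * B) ^ d = (B * C) ^ d * B := by
      induction d with
      | zero => simp
      | succ d ih => rw [pow_succ, ← Matrix.mul_assoc, ih, pow_succ]; simp only [Matrix.mul_assoc]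
    simp only [aeval_monomial, eq_intCast, ← zsmul_eq_mul, Matrix.mul_smul, Matrix.smul_mul, key]

theorem fromBlocks_sub {m n : Type*} (A A' : Matrix m m ℝ) (B B' : Matrix m n ℝ)
    (C C' : Matrix n m ℝ) (D D' : Matrix n n ℝ) :
    fromBlocks A B C D - fromBlocks A' B' C' D' =
      fromBlocks (A - A') (B - B') (C - C') (D - D') := by
  simp only [sub_eq_add_neg, fromBlocks_neg, fromBlocks_add]

theorem eq_zero_of_zero_eq_two_nsmul {m n : Type*} {A : Matrix m n ℝ} (h : 0 = 2 • A) :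
    A = 0 := by
  ext i j
  simpa using (congrFun₂ h i j).symm

/-- The even-indexed off-diagonal blocks are only described through their products with `B`
and `C`. -/
theorem blocks_eq {m n : Type*} [Fintype m] [Fintype n] [DecidableEq m] [DecidableEq n]
    (B : Matrix m n ℝ) (C : Matrix n m ℝ) (S T : ℕ → Matrix (m ⊕ n) (m ⊕ n) ℝ)
    (hS1 : S 1 = fromBlocks (2 • (1 : Matrix m m ℝ)) B 0 0)
    (hT1 : T 1 = fromBlocks 0 0 C (2 • (1 : Matrix n n ℝ)))
    (hS2 : S 2 = S 1 * T 1) (hT2 : T 2 = T 1 * S 1)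
    (hSrec : ∀ i, 2 ≤ i → S (i + 1) = S 1 * T i - S (i - 1))
    (hTrec : ∀ i, 2 ≤ i → T (i + 1) = T 1 * S i - T (i - 1)) (k : ℕ) :
    (S (2 * k + 1) = fromBlocks (2 • aeval (B * C) (fpoly (2 * k + 1)))
        (aeval (B * C) (fpoly (2 * k + 1)) * B) 0 0 ∧
      T (2 * k + 1) = fromBlocks 0 0 (aeval (C * B) (fpoly (2 * k + 1)) * C)
        (2 • aeval (C * B) (fpoly (2 * k + 1)))) ∧
    ∃ M N, S (2 * k + 2) = fromBlocks (aeval (B * C) (fpoly (2 * k + 2))) M 0 0 ∧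
      T (2 * k + 2) = fromBlocks 0 0 N (aeval (C * B) (fpoly (2 * k + 2))) ∧
      C * M = 2 • aeval (C * B) (fpoly (2 * k + 2)) ∧
      B * N = 2 • aeval (B * C) (fpoly (2 * k + 2)) := by
  induction k with
  | zero =>
    refine ⟨⟨by simp [hS1, fpoly], by simp [hT1, fpoly]⟩, 2 • B, 2 • C, ?_, ?_, ?_, ?_⟩
    · simp [hS2, hS1, hT1, fpoly_two, fromBlocks_multiply, -nsmul_eq_mul, -nsmul_one]
    · simp [hT2, hS1, hT1, fpoly_two, fromBlocks_multiply, -nsmul_eq_mul, -nsmul_one]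
    · simp [fpoly_two]
    · simp [fpoly_two]
  | succ k ih =>
    obtain ⟨⟨hS, hT⟩, M, N, hS', hT', hM, hN⟩ := ih
    have hB := aeval_mul_intertwine B C
    have hC := aeval_mul_intertwine C B
    have hS3 : S (2 * k + 3) = fromBlocks (2 • aeval (B * C) (fpoly (2 * k + 3)))
        (aeval (B * C) (fpoly (2 * k + 3)) * B) 0 0 := by
      rw [hSrec (2 * k + 2) (by omega), show 2 * k + 2 - 1 = 2 * k + 1 by omega, hS, hS1, hT',
        fromBlocks_multiply, fpoly_odd, fromBlocks_sub]
      simp [hN, hB, Matrix.sub_mul, smul_sub, -nsmul_eq_mul]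
    have hT3 : T (2 * k + 3) = fromBlocks 0 0 (aeval (C * B) (fpoly (2 * k + 3)) * C)
        (2 • aeval (C * B) (fpoly (2 * k + 3))) := by
      rw [hTrec (2 * k + 2) (by omega), show 2 * k + 2 - 1 = 2 * k + 1 by omega, hT, hT1, hS',
        fromBlocks_multiply, fpoly_odd, fromBlocks_sub]
      simp [hM, hC, Matrix.sub_mul, smul_sub, -nsmul_eq_mul]
    refine ⟨⟨hS3, hT3⟩, 2 • (B * aeval (C * B) (fpoly (2 * k + 3))) - M,
      2 • (C * aeval (B * C) (fpoly (2 * k + 3))) - N, ?_, ?_, ?_, ?_⟩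
    · change S (2 * k + 4) = fromBlocks (aeval _ (fpoly (2 * k + 4))) _ _ _
      rw [hSrec (2 * k + 3) (by omega), show 2 * k + 3 - 1 = 2 * k + 2 by omega, hS', hS1, hT3,
        fromBlocks_multiply, fpoly_even, fromBlocks_sub]
      simp [← hC, Matrix.mul_assoc, -nsmul_eq_mul]
    · change T (2 * k + 4) = fromBlocks _ _ _ (aeval _ (fpoly (2 * k + 4)))
      rw [hTrec (2 * k + 3) (by omega), show 2 * k + 3 - 1 = 2 * k + 2 by omega, hT', hT1, hS3,
        fromBlocks_multiply, fpoly_even, fromBlocks_sub]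
      simp [← hB, Matrix.mul_assoc, -nsmul_eq_mul]
    · change _ = 2 • aeval _ (fpoly (2 * k + 4))
      rw [fpoly_even]
      simp [Matrix.mul_sub, hM, smul_sub, Matrix.mul_assoc, -nsmul_eq_mul]
    · change _ = 2 • aeval _ (fpoly (2 * k + 4))
      rw [fpoly_even]
      simp [Matrix.mul_sub, hN, smul_sub, Matrix.mul_assoc, -nsmul_eq_mul]

/-- with `S₁ = [[2I,B],[0,0]]`, `T₁ = [[0,0],[C,2I]]` (`C = Bᵀ`),
`S₂ = S₁T₁`, `T₂ = T₁S₁`, `S_{i+1} = S₁Tᵢ − S_{i−1}`, `T_{i+1} = T₁Sᵢ − T_{i−1}`: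
if `Sₙ = 0` and `Tₙ = 0` for some `n ≥ 1`, then `fₙ(B·Bᵀ) = 0` and `fₙ(Bᵀ·B) = 0`. -/
theorem statement10 {p q : ℕ} (B : Matrix (Fin p) (Fin q) ℝ)
    (C : Matrix (Fin q) (Fin p) ℝ) (hC : C = Bᵀ)
    (S T : ℕ → Matrix (Fin p ⊕ Fin q) (Fin p ⊕ Fin q) ℝ)
    (hS1 : S 1 = fromBlocks (2 • (1 : Matrix (Fin p) (Fin p) ℝ)) B 0 0)
    (hT1 : T 1 = fromBlocks 0 0 C (2 • (1 : Matrix (Fin q) (Fin q) ℝ)))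
    (hS2 : S 2 = S 1 * T 1) (hT2 : T 2 = T 1 * S 1)
    (hSrec : ∀ i, 2 ≤ i → S (i + 1) = S 1 * T i - S (i - 1))
    (hTrec : ∀ i, 2 ≤ i → T (i + 1) = T 1 * S i - T (i - 1))
    (n : ℕ) (hn : 1 ≤ n) (hSn : S n = 0) (hTn : T n = 0) :
    aeval (B * Bᵀ) (fpoly n) = 0 ∧ aeval (Bᵀ * B) (fpoly n) = 0 := by
  subst hC
  have h := blocks_eq B Bᵀ S T hS1 hT1 hS2 hT2 hSrec hTrec
  obtain ⟨k, rfl | rfl⟩ : ∃ k, n = 2 * k + 1 ∨ n = 2 * k + 2 := ⟨(n - 1) / 2, by omega⟩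
  · obtain ⟨⟨hS, hT⟩, -⟩ := h k
    rw [hSn, ← fromBlocks_zero, fromBlocks_inj] at hS
    rw [hTn, ← fromBlocks_zero, fromBlocks_inj] at hT
    exact ⟨eq_zero_of_zero_eq_two_nsmul hS.1, eq_zero_of_zero_eq_two_nsmul hT.2.2.2⟩
  · obtain ⟨-, M, N, hS, hT, -, -⟩ := h k
    rw [hSn, ← fromBlocks_zero, fromBlocks_inj] at hS
    rw [hTn, ← fromBlocks_zero, fromBlocks_inj] at hT
    exact ⟨hS.1.symm, hT.2.2.2.symm⟩
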